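/- arXiv:math/0512430 — 2 statements merged into one kernel-verified Lean document; each statement's English description precedes it below -/
import Mathlib

section
/- Let Ω ⊆ ℝ^d be a domain and let Pu(x) = −∑_{i,j=1}^d a_ij(x)∂_i∂_j u(x) + ∑_{i=1}^d b_i(x)∂_i u(x) + c(x)u(x), where the real coefficients a_ij, b_i, c are continuous on Ω and the matrix (a_ij(x)) is symmetric and positive semidefinite for every x ∈ Ω. Let V₀, V₁ be continuous real functions on Ω, and suppose u₀, u₁ ∈ C²(Ω) are positive on Ω and satisfy (P + V₀)u₀ ≥ 0 and (P + V₁)u₁ ≥ 0 pointwise in Ω. Then for every s ∈ [0,1] the function u_s := u₀^{1−s} u₁^s is positive, belongs to C²(Ω), and satisfies (P + sV₁ + (1−s)V₀)u_s ≥ 0 pointwise in Ω. -/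
open MeasureTheory

noncomputable section

/-- The first partial derivative ∂ᵢu(x). -/
def pd1 {d : ℕ} (u : (Fin d → ℝ) → ℝ) (i : Fin d) (x : Fin d → ℝ) : ℝ :=
  fderiv ℝ u x (Pi.single i 1)

/-- The second partial derivative ∂ᵢ∂ⱼu(x). -/
def pd2 {d : ℕ} (u : (Fin d → ℝ) → ℝ) (i j : Fin d) (x : Fin d → ℝ) : ℝ :=
  fderiv ℝ (fun y => fderiv ℝ u y (Pi.single j 1)) x (Pi.single i 1)

/-- The second-order elliptic operator
`Pu = -∑ᵢⱼ aᵢⱼ ∂ᵢ∂ⱼu + ∑ᵢ bᵢ ∂ᵢu + c u`. -/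
def ellOp {d : ℕ} (a : Fin d → Fin d → (Fin d → ℝ) → ℝ) (b : Fin d → (Fin d → ℝ) → ℝ)
    (c : (Fin d → ℝ) → ℝ) (u : (Fin d → ℝ) → ℝ) (x : Fin d → ℝ) : ℝ :=
  -(∑ i, ∑ j, a i j x * pd2 u i j x) + (∑ i, b i x * pd1 u i x) + c x * u x

theorem pd1_interp {d : ℕ} (u₀ u₁ : (Fin d → ℝ) → ℝ) (s : ℝ) (y v : Fin d → ℝ)
    (h0 : DifferentiableAt ℝ u₀ y) (h1 : DifferentiableAt ℝ u₁ y)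
    (p0 : 0 < u₀ y) (p1 : 0 < u₁ y) :
    fderiv ℝ (fun y => u₀ y ^ (1 - s) * u₁ y ^ s) y v =
      (u₀ y ^ (1 - s) * u₁ y ^ s) *
        ((1 - s) * (fderiv ℝ u₀ y v * (u₀ y)⁻¹) + s * (fderiv ℝ u₁ y v * (u₁ y)⁻¹)) := by
  have e0 := h0.hasFDerivAt.rpow_const (p := 1 - s) (Or.inl p0.ne')
  have e1 := h1.hasFDerivAt.rpow_const (p := s) (Or.inl p1.ne')
  have e := (e0.mul e1).fderiv
  have e' : fderiv ℝ (fun y => u₀ y ^ (1 - s) * u₁ y ^ s) y = _ := e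
  rw [e']
  simp only [ContinuousLinearMap.add_apply, ContinuousLinearMap.smul_apply, smul_eq_mul]
  rw [Real.rpow_sub_one p0.ne', Real.rpow_sub_one p1.ne']
  field_simp
  ring

theorem pd2_interp {d : ℕ} (Ω : Set (Fin d → ℝ)) (hopen : IsOpen Ω)
    (u₀ u₁ : (Fin d → ℝ) → ℝ)
    (hu₀ : ContDiffOn ℝ 2 u₀ Ω) (hu₁ : ContDiffOn ℝ 2 u₁ Ω)
    (hu₀pos : ∀ x ∈ Ω, 0 < u₀ x) (hu₁pos : ∀ x ∈ Ω, 0 < u₁ x) (s : ℝ)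
    (x : Fin d → ℝ) (hx : x ∈ Ω) (i j : Fin d) :
    pd2 (fun y => u₀ y ^ (1 - s) * u₁ y ^ s) i j x =
      (u₀ x ^ (1 - s) * u₁ x ^ s) *
        ((1 - s) * (pd2 u₀ i j x / u₀ x) + s * (pd2 u₁ i j x / u₁ x)
          - s * (1 - s) * ((pd1 u₀ i x / u₀ x - pd1 u₁ i x / u₁ x) *
            (pd1 u₀ j x / u₀ x - pd1 u₁ j x / u₁ x))) := by
  have D0 : ∀ y ∈ Ω, DifferentiableAt ℝ u₀ y := fun y hy =>
    (hu₀.contDiffAt (hopen.mem_nhds hy)).differentiableAt (by norm_num)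
  have D1 : ∀ y ∈ Ω, DifferentiableAt ℝ u₁ y := fun y hy =>
    (hu₁.contDiffAt (hopen.mem_nhds hy)).differentiableAt (by norm_num)
  have DD : ∀ u : (Fin d → ℝ) → ℝ, ContDiffOn ℝ 2 u Ω → DifferentiableAt ℝ
      (fun y => fderiv ℝ u y (Pi.single j 1)) x := fun u hu => by
    have h := ((hu.contDiffAt (hopen.mem_nhds hx)).fderiv_right (m := 1)
      (by norm_num)).differentiableAt (by norm_num)
    exact h.clm_apply (differentiableAt_const _)
  have p0 := hu₀pos x hx
  have p1 := hu₁pos x hx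
  have ev : (fun y => fderiv ℝ (fun y => u₀ y ^ (1 - s) * u₁ y ^ s) y (Pi.single j 1))
      =ᶠ[nhds x] (fun y => (u₀ y ^ (1 - s) * u₁ y ^ s) *
        ((1 - s) * (fderiv ℝ u₀ y (Pi.single j 1) * (u₀ y)⁻¹)
          + s * (fderiv ℝ u₁ y (Pi.single j 1) * (u₁ y)⁻¹))) := by
    filter_upwards [hopen.mem_nhds hx] with y hy
    exact pd1_interp u₀ u₁ s y _ (D0 y hy) (D1 y hy) (hu₀pos y hy) (hu₁pos y hy)
  have eU : HasFDerivAt (fun y => u₀ y ^ (1 - s) * u₁ y ^ s) _ x :=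
    (((D0 x hx).rpow_const (p := 1 - s) (Or.inl p0.ne')).mul
      ((D1 x hx).rpow_const (p := s) (Or.inl p1.ne'))).hasFDerivAt
  have i0 : HasFDerivAt (fun y => (u₀ y)⁻¹) _ x :=
    (hasDerivAt_inv p0.ne').comp_hasFDerivAt x (D0 x hx).hasFDerivAt
  have i1 : HasFDerivAt (fun y => (u₁ y)⁻¹) _ x :=
    (hasDerivAt_inv p1.ne').comp_hasFDerivAt x (D1 x hx).hasFDerivAt
  have e := (eU.mul ((((DD u₀ hu₀).hasFDerivAt.mul i0).const_mul (1 - s)).add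
    (((DD u₁ hu₁).hasFDerivAt.mul i1).const_mul s))).fderiv
  have e' : fderiv ℝ (fun y => (u₀ y ^ (1 - s) * u₁ y ^ s) *
        ((1 - s) * (fderiv ℝ u₀ y (Pi.single j 1) * (u₀ y)⁻¹)
          + s * (fderiv ℝ u₁ y (Pi.single j 1) * (u₁ y)⁻¹))) x = _ := e
  have hU : fderiv ℝ ((fun y => u₀ y ^ (1 - s)) * (fun y => u₁ y ^ s)) x (Pi.single i 1) = _ :=
    pd1_interp u₀ u₁ s x (Pi.single i 1) (D0 x hx) (D1 x hx) p0 p1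
  unfold pd2 pd1
  rw [ev.fderiv_eq, e']
  simp only [ContinuousLinearMap.add_apply, ContinuousLinearMap.smul_apply, smul_eq_mul,
    Pi.add_apply, Pi.mul_apply]
  rw [hU]
  generalize u₀ x ^ (1 - s) * u₁ x ^ s = U
  field_simp
  ring

/-- The interpolation lemma (proof of Theorem 2.9): if `u₀, u₁` are positive C²
supersolutions of `(P + V₀)u ≥ 0`, `(P + V₁)u ≥ 0` in Ω, then for `s ∈ [0,1]` the
function `u_s = u₀^{1-s} u₁^s` is a positive C² supersolution of
`(P + sV₁ + (1-s)V₀)u ≥ 0` in Ω. -/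
theorem stmt1 (d : ℕ) (Ω : Set (Fin d → ℝ)) (hopen : IsOpen Ω) (hconn : IsConnected Ω)
    (a : Fin d → Fin d → (Fin d → ℝ) → ℝ) (b : Fin d → (Fin d → ℝ) → ℝ)
    (c : (Fin d → ℝ) → ℝ)
    (ha : ∀ i j, ContinuousOn (a i j) Ω) (hb : ∀ i, ContinuousOn (b i) Ω)
    (hc : ContinuousOn c Ω)
    (hsym : ∀ x ∈ Ω, ∀ i j, a i j x = a j i x)
    (hpsd : ∀ x ∈ Ω, ∀ ξ : Fin d → ℝ, 0 ≤ ∑ i, ∑ j, a i j x * ξ i * ξ j)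
    (V₀ V₁ : (Fin d → ℝ) → ℝ) (hV₀ : ContinuousOn V₀ Ω) (hV₁ : ContinuousOn V₁ Ω)
    (u₀ u₁ : (Fin d → ℝ) → ℝ)
    (hu₀ : ContDiffOn ℝ 2 u₀ Ω) (hu₁ : ContDiffOn ℝ 2 u₁ Ω)
    (hu₀pos : ∀ x ∈ Ω, 0 < u₀ x) (hu₁pos : ∀ x ∈ Ω, 0 < u₁ x)
    (hu₀super : ∀ x ∈ Ω, 0 ≤ ellOp a b c u₀ x + V₀ x * u₀ x)
    (hu₁super : ∀ x ∈ Ω, 0 ≤ ellOp a b c u₁ x + V₁ x * u₁ x)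
    (s : ℝ) (hs : s ∈ Set.Icc (0 : ℝ) 1) :
    (∀ x ∈ Ω, 0 < u₀ x ^ (1 - s) * u₁ x ^ s) ∧
    ContDiffOn ℝ 2 (fun x => u₀ x ^ (1 - s) * u₁ x ^ s) Ω ∧
    (∀ x ∈ Ω, 0 ≤ ellOp a b c (fun y => u₀ y ^ (1 - s) * u₁ y ^ s) x +
      (s * V₁ x + (1 - s) * V₀ x) * (u₀ x ^ (1 - s) * u₁ x ^ s)) := by
  have hpos : ∀ x ∈ Ω, 0 < u₀ x ^ (1 - s) * u₁ x ^ s := fun x hx =>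
    mul_pos (Real.rpow_pos_of_pos (hu₀pos x hx) _) (Real.rpow_pos_of_pos (hu₁pos x hx) _)
  refine ⟨hpos, ?_, ?_⟩
  · exact (hu₀.rpow_const_of_ne fun x hx => (hu₀pos x hx).ne').mul
      (hu₁.rpow_const_of_ne fun x hx => (hu₁pos x hx).ne')
  · intro x hx
    have p0 := hu₀pos x hx
    have p1 := hu₁pos x hx
    have hU := hpos x hx
    have key : ellOp a b c (fun y => u₀ y ^ (1 - s) * u₁ y ^ s) x +
        (s * V₁ x + (1 - s) * V₀ x) * (u₀ x ^ (1 - s) * u₁ x ^ s) =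
        (u₀ x ^ (1 - s) * u₁ x ^ s) *
          ((1 - s) * ((ellOp a b c u₀ x + V₀ x * u₀ x) / u₀ x)
          + s * ((ellOp a b c u₁ x + V₁ x * u₁ x) / u₁ x)
          + s * (1 - s) * ∑ i, ∑ j, a i j x * (pd1 u₀ i x / u₀ x - pd1 u₁ i x / u₁ x) *
            (pd1 u₀ j x / u₀ x - pd1 u₁ j x / u₁ x)) := by
      have A : ∑ i, ∑ j, a i j x * pd2 (fun y => u₀ y ^ (1 - s) * u₁ y ^ s) i j x =
          (u₀ x ^ (1 - s) * u₁ x ^ s) *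
          ((1 - s) * ((∑ i, ∑ j, a i j x * pd2 u₀ i j x) / u₀ x)
          + s * ((∑ i, ∑ j, a i j x * pd2 u₁ i j x) / u₁ x)
          - s * (1 - s) * ∑ i, ∑ j, a i j x * (pd1 u₀ i x / u₀ x - pd1 u₁ i x / u₁ x) *
            (pd1 u₀ j x / u₀ x - pd1 u₁ j x / u₁ x)) := by
        simp only [Finset.sum_div, Finset.mul_sum, ← Finset.sum_add_distrib,
          ← Finset.sum_sub_distrib]
        refine Finset.sum_congr rfl fun i _ => Finset.sum_congr rfl fun j _ => ?_
        rw [pd2_interp Ω hopen u₀ u₁ hu₀ hu₁ hu₀pos hu₁pos s x hx i j]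
        ring
      have B : ∑ i, b i x * pd1 (fun y => u₀ y ^ (1 - s) * u₁ y ^ s) i x =
          (u₀ x ^ (1 - s) * u₁ x ^ s) *
          ((1 - s) * ((∑ i, b i x * pd1 u₀ i x) / u₀ x)
          + s * ((∑ i, b i x * pd1 u₁ i x) / u₁ x)) := by
        simp only [Finset.sum_div, Finset.mul_sum, ← Finset.sum_add_distrib]
        refine Finset.sum_congr rfl fun i _ => ?_
        have h := pd1_interp u₀ u₁ s x (Pi.single i 1)
          ((hu₀.contDiffAt (hopen.mem_nhds hx)).differentiableAt (by norm_num))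
          ((hu₁.contDiffAt (hopen.mem_nhds hx)).differentiableAt (by norm_num)) p0 p1
        unfold pd1
        rw [h]
        ring
      unfold ellOp
      rw [A, B]
      beta_reduce
      generalize u₀ x ^ (1 - s) * u₁ x ^ s = U
      generalize (∑ i, ∑ j, a i j x * (pd1 u₀ i x / u₀ x - pd1 u₁ i x / u₁ x) *
            (pd1 u₀ j x / u₀ x - pd1 u₁ j x / u₁ x)) = Q
      field_simp
      ring
    rw [key]
    have h0 := div_nonneg (hu₀super x hx) p0.le
    have h1 := div_nonneg (hu₁super x hx) p1.le
    have hQ := hpsd x hx (fun i => pd1 u₀ i x / u₀ x - pd1 u₁ i x / u₁ x)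
    have s0 : 0 ≤ s := hs.1
    have s1 : 0 ≤ 1 - s := sub_nonneg.2 hs.2
    exact mul_nonneg hU.le (add_nonneg (add_nonneg (mul_nonneg s1 h0) (mul_nonneg s0 h1))
      (mul_nonneg (mul_nonneg s0 s1) hQ))
end
end

section
/- Let d = 1 or d = 2, and let W ∈ C_c^∞(ℝ^d) be real-valued with W not identically zero. Then the following are equivalent: (a) for every λ < 0 there exists u ∈ C_c^∞(ℝ^d) with ∫_{ℝ^d} (|∇u(x)|² − λ W(x) u(x)²) dx < 0; (b) ∫_{ℝ^d} W(x) dx ≤ 0. -/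
open MeasureTheory

noncomputable section

abbrev Ed (d : ℕ) := EuclideanSpace ℝ (Fin d)

/-- A smooth compactly supported test function on ℝ^d. -/
def IsTest {d : ℕ} (u : Ed d → ℝ) : Prop :=
  ContDiff ℝ (⊤ : ℕ∞) u ∧ HasCompactSupport u

lemma norm_gradient_eq {d : ℕ} (u : Ed d → ℝ) (x : Ed d) : ‖gradient u x‖ = ‖fderiv ℝ u x‖ := by
  simp [gradient]

lemma IsTest.cont_fderiv {d : ℕ} {u : Ed d → ℝ} (hu : IsTest u) : Continuous (fderiv ℝ u) :=
  hu.1.continuous_fderiv (by simp)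

lemma IsTest.diff {d : ℕ} {u : Ed d → ℝ} (hu : IsTest u) : Differentiable ℝ u :=
  hu.1.differentiable (by simp)

lemma IsTest.int_sq {d : ℕ} {u : Ed d → ℝ} (hu : IsTest u) :
    Integrable (fun x => ‖fderiv ℝ u x‖ ^ 2) := by
  apply Continuous.integrable_of_hasCompactSupport
  · exact hu.cont_fderiv.norm.pow 2
  · exact (hu.2.fderiv (𝕜 := ℝ)).comp_left (g := fun z => ‖z‖ ^ 2) (by simp)

/-- pointwise bound -/
lemma pt_bound {d : ℕ} {u : Ed d → ℝ} (hu : IsTest u) (x h : Ed d) :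
    (u (x + h) - u x) ^ 2 ≤ ‖h‖ ^ 2 * ∫ t in (0:ℝ)..1, ‖fderiv ℝ u (x + t • h)‖ ^ 2 := by
  have hc : Continuous fun t : ℝ => fderiv ℝ u (x + t • h) := hu.cont_fderiv.comp (by fun_prop)
  have hc2 : Continuous fun t : ℝ => fderiv ℝ u (x + t • h) h := hc.clm_apply continuous_const
  have h1 : ∫ t in (0:ℝ)..1, fderiv ℝ u (x + t • h) h = u (x + h) - u x := by
    have := intervalIntegral.integral_eq_sub_of_hasDerivAt (a := 0) (b := 1)
      (f := fun t : ℝ => u (x + t • h)) (f' := fun t : ℝ => fderiv ℝ u (x + t • h) h)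
      (fun t _ => by
        have h2 : HasDerivAt (fun t : ℝ => x + t • h) h t := by
          simpa using ((hasDerivAt_id t).smul_const h).const_add x
        exact (hu.diff (x + t • h)).hasFDerivAt.comp_hasDerivAt t h2)
      (hc2.intervalIntegrable _ _)
    simpa using this
  set c := u (x + h) - u x with hcdef
  have h3 : 0 ≤ ∫ t in (0:ℝ)..1, (fderiv ℝ u (x + t • h) h - c) ^ 2 :=
    intervalIntegral.integral_nonneg (by norm_num) (fun t _ => sq_nonneg _)
  have h4 : ∫ t in (0:ℝ)..1, (fderiv ℝ u (x + t • h) h - c) ^ 2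
      = (∫ t in (0:ℝ)..1, (fderiv ℝ u (x + t • h) h) ^ 2) - c ^ 2 := by
    have e : ∀ t : ℝ, (fderiv ℝ u (x + t • h) h - c) ^ 2
      = (fderiv ℝ u (x + t • h) h) ^ 2 - (2 * c) * (fderiv ℝ u (x + t • h) h) + c ^ 2 := by
      intro t; ring
    simp_rw [e]
    rw [intervalIntegral.integral_add, intervalIntegral.integral_sub,
      intervalIntegral.integral_const_mul, h1]
    · simp; ring
    all_goals exact Continuous.intervalIntegrable (by fun_prop) _ _
  have h5 : (∫ t in (0:ℝ)..1, (fderiv ℝ u (x + t • h) h) ^ 2)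
      ≤ ∫ t in (0:ℝ)..1, ‖h‖ ^ 2 * ‖fderiv ℝ u (x + t • h)‖ ^ 2 := by
    apply intervalIntegral.integral_mono_on (by norm_num)
    · exact Continuous.intervalIntegrable (by fun_prop) _ _
    · exact Continuous.intervalIntegrable (by fun_prop) _ _
    · intro t _
      have := (fderiv ℝ u (x + t • h)).le_opNorm h
      rw [← mul_pow, ← sq_abs, ← Real.norm_eq_abs, mul_comm ‖h‖]
      gcongr
  rw [intervalIntegral.integral_const_mul] at h5
  linarith

lemma pt_bound_l {d : ℕ} {u : Ed d → ℝ} (hu : IsTest u) (x h : Ed d) :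
    ENNReal.ofReal ((u (x + h) - u x) ^ 2) ≤ ENNReal.ofReal (‖h‖ ^ 2) *
      ∫⁻ t in Set.Ioc (0:ℝ) 1, ENNReal.ofReal (‖fderiv ℝ u (x + t • h)‖ ^ 2) := by
  have hc : Continuous fun t : ℝ => ‖fderiv ℝ u (x + t • h)‖ ^ 2 :=
    (hu.cont_fderiv.comp (by fun_prop)).norm.pow 2
  rw [← ofReal_integral_eq_lintegral_ofReal, ← ENNReal.ofReal_mul (by positivity)]
  · apply ENNReal.ofReal_le_ofReal
    rw [← intervalIntegral.integral_of_le (by norm_num)]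
    exact pt_bound hu x h
  · have := hc.intervalIntegrable (μ := volume) 0 1
    rwa [intervalIntegrable_iff_integrableOn_Ioc_of_le (by norm_num)] at this
  · exact Filter.Eventually.of_forall fun t => by positivity

lemma trans_bound {d : ℕ} {u : Ed d → ℝ} (hu : IsTest u) (h : Ed d) :
    ∫⁻ x, ENNReal.ofReal ((u (x + h) - u x) ^ 2) ≤ ENNReal.ofReal (‖h‖ ^ 2) *
      ∫⁻ x, ENNReal.ofReal (‖fderiv ℝ u x‖ ^ 2) := by
  have hcf := hu.cont_fderiv
  calc ∫⁻ x, ENNReal.ofReal ((u (x + h) - u x) ^ 2)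
      ≤ ∫⁻ x, ENNReal.ofReal (‖h‖ ^ 2) *
      ∫⁻ t in Set.Ioc (0:ℝ) 1, ENNReal.ofReal (‖fderiv ℝ u (x + t • h)‖ ^ 2) :=
        lintegral_mono fun x => pt_bound_l hu x h
    _ = ENNReal.ofReal (‖h‖ ^ 2) * ∫⁻ x, 
      ∫⁻ t in Set.Ioc (0:ℝ) 1, ENNReal.ofReal (‖fderiv ℝ u (x + t • h)‖ ^ 2) :=
        lintegral_const_mul' _ _ ENNReal.ofReal_ne_top
    _ = ENNReal.ofReal (‖h‖ ^ 2) *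
      ∫⁻ t in Set.Ioc (0:ℝ) 1, ∫⁻ x, ENNReal.ofReal (‖fderiv ℝ u (x + t • h)‖ ^ 2) := by
        rw [lintegral_lintegral_swap]
        apply Measurable.aemeasurable
        apply Measurable.ennreal_ofReal
        apply Continuous.measurable
        exact (hcf.comp (by fun_prop)).norm.pow 2
    _ = ENNReal.ofReal (‖h‖ ^ 2) *
      ∫⁻ t in Set.Ioc (0:ℝ) 1, ∫⁻ x, ENNReal.ofReal (‖fderiv ℝ u x‖ ^ 2) := by
        congr 2; ext t
        exact lintegral_add_right_eq_self
          (fun x => ENNReal.ofReal (‖fderiv ℝ u x‖ ^ 2)) (t • h)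
    _ = _ := by simp

lemma double_bound {d : ℕ} {u : Ed d → ℝ} (hu : IsTest u) (R : ℝ) :
    ∫⁻ x, ∫⁻ h in Metric.closedBall (0 : Ed d) R, ENNReal.ofReal ((u (x + h) - u x) ^ 2) ≤
      ENNReal.ofReal (R ^ 2) * volume (Metric.closedBall (0 : Ed d) R) *
      ∫⁻ x, ENNReal.ofReal (‖fderiv ℝ u x‖ ^ 2) := by
  have hcf := hu.1.continuous
  rw [lintegral_lintegral_swap]
  · calc _ ≤ ∫⁻ h in Metric.closedBall (0 : Ed d) R, ENNReal.ofReal (R ^ 2) *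
          ∫⁻ x, ENNReal.ofReal (‖fderiv ℝ u x‖ ^ 2) := by
          apply setLIntegral_mono measurable_const
          intro h hh
          refine (trans_bound hu h).trans ?_
          have : ‖h‖ ≤ R := by simpa using hh
          gcongr
      _ = _ := by simp; ring
  · apply Measurable.aemeasurable
    apply Measurable.ennreal_ofReal
    apply Continuous.measurable
    change Continuous fun p : Ed d × Ed d => (u (p.1 + p.2) - u p.1) ^ 2
    fun_prop

lemma poincare {d : ℕ} {W : Ed d → ℝ} (hW : Continuous W) (hWc : HasCompactSupport W) :
    ∃ K : ℝ, 0 ≤ K ∧ ∀ u : Ed d → ℝ, IsTest u →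
      -(K * ∫ x, ‖fderiv ℝ u x‖ ^ 2) ≤ ∫ x, ∫ y, W x * W y * (u x - u y) ^ 2 := by
  obtain ⟨M, hM⟩ := hWc.exists_bound_of_continuous hW
  obtain ⟨R, hR0, hR⟩ := hWc.isCompact.isBounded.subset_closedBall_lt 0 0
  have hM0 : 0 ≤ M := (norm_nonneg _).trans (hM 0)
  have hsupp : ∀ x, W x ≠ 0 → ‖x‖ ≤ R := fun x hx => by
    simpa using hR (subset_tsupport _ hx)
  set V := volume (Metric.closedBall (0 : Ed d) (2 * R)) with hV
  have hVt : V ≠ ⊤ := measure_closedBall_lt_top.ne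
  refine ⟨M ^ 2 * (2 * R) ^ 2 * V.toReal, by positivity, fun u hu => ?_⟩
  have key : ‖∫ x, ∫ y, W x * W y * (u x - u y) ^ 2‖ₑ ≤
      ENNReal.ofReal (M ^ 2 * (2 * R) ^ 2 * V.toReal * ∫ x, ‖fderiv ℝ u x‖ ^ 2) := by
    calc ‖∫ x, ∫ y, W x * W y * (u x - u y) ^ 2‖ₑ 
      ≤ ∫⁻ x, ‖∫ y, W x * W y * (u x - u y) ^ 2‖ₑ := enorm_integral_le_lintegral_enorm _
    _ ≤ ∫⁻ x, ∫⁻ y, ‖W x * W y * (u x - u y) ^ 2‖ₑ := 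
        lintegral_mono fun x => enorm_integral_le_lintegral_enorm _
    _ = ∫⁻ x, ∫⁻ h, ‖W x * W (x + h) * (u x - u (x + h)) ^ 2‖ₑ := by
        congr 1; ext x
        exact (lintegral_add_left_eq_self (fun y => ‖W x * W y * (u x - u y) ^ 2‖ₑ) x).symm
    _ ≤ ∫⁻ x, ∫⁻ h in Metric.closedBall (0 : Ed d) (2 * R), ENNReal.ofReal (M ^ 2) *
          ENNReal.ofReal ((u (x + h) - u x) ^ 2) := by
        apply lintegral_mono fun x => ?_
        rw [← lintegral_indicator measurableSet_closedBall]
        apply lintegral_mono fun h => ?_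
        by_cases hz : W x * W (x + h) = 0
        · simp [hz]
        · have h1 := hsupp x (left_ne_zero_of_mul hz)
          have h2 := hsupp (x + h) (right_ne_zero_of_mul hz)
          have h3 : h ∈ Metric.closedBall (0 : Ed d) (2 * R) := by
            have : ‖h‖ ≤ ‖x + h‖ + ‖x‖ := by
              simpa using norm_sub_le (x + h) x
            simp; linarith
          simp only [Set.indicator_of_mem h3]
          rw [← ENNReal.ofReal_mul (by positivity), ← ofReal_norm]
          apply ENNReal.ofReal_le_ofReal
          rw [norm_mul, norm_mul, norm_pow, Real.norm_eq_abs (u x - _), sq_abs, pow_two M,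
            ← neg_sub, neg_sq]
          gcongr
          · exact hM _
          · exact hM _
    _ = ENNReal.ofReal (M ^ 2) * ∫⁻ x, ∫⁻ h in Metric.closedBall (0 : Ed d) (2 * R),
          ENNReal.ofReal ((u (x + h) - u x) ^ 2) := by
        simp_rw [lintegral_const_mul' _ _ ENNReal.ofReal_ne_top]
    _ ≤ ENNReal.ofReal (M ^ 2) * (ENNReal.ofReal ((2 * R) ^ 2) * V *
          ∫⁻ x, ENNReal.ofReal (‖fderiv ℝ u x‖ ^ 2)) := by
        gcongr
        exact double_bound hu _
    _ = _ := by
        rw [← ofReal_integral_eq_lintegral_ofReal hu.int_sq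
          (Filter.Eventually.of_forall fun t => by positivity)]
        rw [ENNReal.ofReal_mul (by positivity), ENNReal.ofReal_mul (by positivity),
          ENNReal.ofReal_mul (by positivity), ENNReal.ofReal_toReal hVt]
        ring
  rw [← ofReal_norm, ENNReal.ofReal_le_ofReal_iff (by positivity)] at key
  exact neg_le_of_abs_le key

lemma int3 {d : ℕ} {a b c : Ed d → ℝ} (ha : Integrable a) (hb : Integrable b) (hc : Integrable c) :
    ∫ x, (a x - b x + c x) = (∫ x, a x) - (∫ x, b x) + ∫ x, c x := by
  have h1 : ∫ x, (a x - b x) = (∫ x, a x) - (∫ x, b x) := integral_sub ha hb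
  have h2 : ∫ x, ((a x - b x) + c x) = (∫ x, (a x - b x)) + ∫ x, c x :=
    integral_add (ha.sub hb) hc
  rw [h2, h1]

lemma double_id {d : ℕ} {W u : Ed d → ℝ} (hW : Continuous W) (hWc : HasCompactSupport W)
    (hu : Continuous u) :
    ∫ x, ∫ y, W x * W y * (u x - u y) ^ 2 =
      2 * (∫ x, W x) * (∫ x, W x * u x ^ 2) - 2 * (∫ x, W x * u x) ^ 2 := by
  have i0 : Integrable W := hW.integrable_of_hasCompactSupport hWc
  have i1 : Integrable (fun x => W x * u x) :=
    (hW.mul hu).integrable_of_hasCompactSupport hWc.mul_right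
  have i2 : Integrable (fun x => W x * u x ^ 2) :=
    (hW.mul (hu.pow 2)).integrable_of_hasCompactSupport hWc.mul_right
  have e : ∀ x, ∫ y, W x * W y * (u x - u y) ^ 2 = 
     (W x * u x ^ 2) * (∫ y, W y) - (2 * (∫ y, W y * u y)) * (W x * u x)
      + W x * (∫ y, W y * u y ^ 2) := by
    intro x
    have : ∀ y, W x * W y * (u x - u y) ^ 2 = (W x * u x ^ 2) * W y
      - (2 * (W x * u x)) * (W y * u y) + W x * (W y * u y ^ 2) := fun y => by ring
    simp_rw [this]
    rw [int3 (i0.const_mul _) (i1.const_mul _) (i2.const_mul _)]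
    simp_rw [integral_const_mul]
    ring
  simp_rw [e]
  rw [int3 (i2.mul_const _) (i1.const_mul _) (i0.mul_const _)]
  simp_rw [integral_const_mul, integral_mul_const]
  ring

lemma Q_split {d : ℕ} {W u : Ed d → ℝ} (hW : Continuous W) (hWc : HasCompactSupport W)
    (hu : IsTest u) (l : ℝ) :
    (∫ x, (‖gradient u x‖ ^ 2 - l * W x * u x ^ 2)) =
      (∫ x, ‖fderiv ℝ u x‖ ^ 2) - l * ∫ x, W x * u x ^ 2 := by
  have i2 : Integrable (fun x => W x * u x ^ 2) :=
    (hW.mul (hu.1.continuous.pow 2)).integrable_of_hasCompactSupport hWc.mul_right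
  simp_rw [norm_gradient_eq, mul_assoc]
  rw [integral_sub hu.int_sq (i2.const_mul _), integral_const_mul]

/-- cutoffs -/
lemma cutoff0 {d : ℕ} (hd : d ≤ 2) : ∃ E : ℝ, 0 ≤ E ∧ ∀ s : ℝ, 1 ≤ s → ∃ χ : Ed d → ℝ, IsTest χ ∧
    (∀ x, ‖x‖ < s → χ x = 1) ∧ ∫ x, ‖fderiv ℝ χ x‖ ^ 2 ≤ E := by
  let φ : ContDiffBump (0 : Ed d) := ⟨1, 2, by norm_num, by norm_num⟩
  refine ⟨∫ x, ‖fderiv ℝ φ x‖ ^ 2, by positivity, fun s hs => ⟨fun x => φ (s⁻¹ • x), ⟨?_, ?_⟩, ?_, ?_⟩⟩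
  · exact φ.contDiff.comp (contDiff_const_smul _)
  · exact φ.hasCompactSupport.comp_smul (by positivity)
  · intro x hx
    apply φ.one_of_mem_closedBall
    have : s⁻¹ * ‖x‖ ≤ 1 := by
      rw [inv_mul_le_iff₀ (by positivity)]; linarith
    simpa [norm_smul, abs_of_pos (show 0 < s by positivity)] using this
  · have e : ∀ x, ‖fderiv ℝ (fun x => φ (s⁻¹ • x)) x‖ ^ 2
       = (s⁻¹) ^ 2 * (fun z => ‖fderiv ℝ φ z‖ ^ 2) (s⁻¹ • x) := by
      intro x
      rw [fderiv_comp_smul, norm_smul, mul_pow]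
      simp
    simp_rw [e]
    rw [integral_const_mul,
      Measure.integral_comp_inv_smul volume (fun z => ‖fderiv ℝ φ z‖ ^ 2)]
    have hp : 0 ≤ ∫ x, ‖fderiv ℝ φ x‖ ^ 2 := by positivity
    simp only [finrank_euclideanSpace, Fintype.card_fin, smul_eq_mul]
    rw [← mul_assoc, abs_of_nonneg (by positivity)]
    apply mul_le_of_le_one_left hp
    rw [inv_pow, inv_mul_le_iff₀ (by positivity), mul_one]
    exact pow_le_pow_right₀ hs hd

lemma cutoff1 {d : ℕ} (hd : d ≤ 2) : ∃ E : ℝ, 0 ≤ E ∧ ∀ R : ℝ, ∀ N : ℕ,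
    ∃ χ : Ed d → ℝ, IsTest χ ∧
    (∀ x, ‖x‖ < R → χ x = 1) ∧ ∫ x, ‖fderiv ℝ χ x‖ ^ 2 ≤ E / (N + 1) := by
  obtain ⟨E, hE, h⟩ := cutoff0 hd
  refine ⟨E, hE, fun R N => ?_⟩
  induction N with
  | zero =>
    obtain ⟨χ, h1, h2, h3⟩ := h (max 1 R) (le_max_left _ _)
    exact ⟨χ, h1, fun x hx => h2 x (lt_max_of_lt_right hx), by simpa using h3⟩
  | succ N ih =>
    obtain ⟨χ, h1, h2, h3⟩ := ih
    obtain ⟨S, hS0, hS⟩ := h1.2.isCompact.isBounded.subset_ball_lt 0 0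
    obtain ⟨ψ, k1, k2, k3⟩ := h (max 1 (max R S)) (le_max_left _ _)
    set a : ℝ := (N + 1) / (N + 2) with ha
    set b : ℝ := 1 / (N + 2) with hb
    have hN : (0:ℝ) < N + 2 := by positivity
    have hab : a + b = 1 := by rw [ha, hb]; field_simp; ring
    have hT : IsTest (fun x => a * χ x + b * ψ x) := by
      refine ⟨(contDiff_const.mul h1.1).add (contDiff_const.mul k1.1), ?_⟩
      exact (h1.2.mul_left).add (k1.2.mul_left)
    refine ⟨fun x => a * χ x + b * ψ x, hT, ?_, ?_⟩
    · intro x hx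
      simp only
      rw [h2 x hx, k2 x (lt_max_of_lt_right (lt_max_of_lt_left hx))]
      linarith
    · have e : ∀ x, ‖fderiv ℝ (fun x => a * χ x + b * ψ x) x‖ ^ 2
          = a ^ 2 * ‖fderiv ℝ χ x‖ ^ 2 + b ^ 2 * ‖fderiv ℝ ψ x‖ ^ 2 := by
        intro x
        have e1 : fderiv ℝ (fun x => a * χ x + b * ψ x) x
            = a • fderiv ℝ χ x + b • fderiv ℝ ψ x :=
          (((h1.diff x).hasFDerivAt.const_mul a).add ((k1.diff x).hasFDerivAt.const_mul b)).fderiv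
        rw [e1]
        by_cases hx : ‖x‖ < S
        · have : fderiv ℝ ψ x = 0 := by
            have : ψ =ᶠ[nhds x] fun _ => 1 := by
              filter_upwards [(isOpen_lt continuous_norm continuous_const).mem_nhds hx] with y hy
              exact k2 y (lt_max_of_lt_right (lt_max_of_lt_right hy))
            rw [this.fderiv_eq]; simp
          simp [this, norm_smul, mul_pow]
        · have : fderiv ℝ χ x = 0 := by
            by_contra hne
            have := hS (support_fderiv_subset ℝ hne)
            simp at this
            exact hx this
          simp [this, norm_smul, mul_pow]
      simp_rw [e]
      rw [integral_add (h1.int_sq.const_mul _) (k1.int_sq.const_mul _), integral_const_mul,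
        integral_const_mul]
      calc _ ≤ a ^ 2 * (E / (N + 1)) + b ^ 2 * E := by gcongr
        _ = _ := by
          rw [ha, hb]; push_cast; field_simp; ring

lemma cs_pow {d : ℕ} {W : Ed d → ℝ} (hWc : HasCompactSupport W) (n : ℕ) (hn : n ≠ 0) :
    HasCompactSupport (fun x => W x ^ n) := by
  have := hWc.comp_left (g := fun z : ℝ => z ^ n) (zero_pow hn)
  exact this

/-- Simon's theorem (Theorem 4.1), variational form: for `d = 1, 2` and
`W ∈ C_c^∞(ℝ^d)`, `W ≢ 0`, the operator `-Δ - λW` has a negative eigenvalue for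
every `λ < 0` if and only if `∫ W ≤ 0`. -/
theorem stmt3 (d : ℕ) (hd : d = 1 ∨ d = 2)
    (W : Ed d → ℝ) (hW : ContDiff ℝ (⊤ : ℕ∞) W) (hWc : HasCompactSupport W)
    (hWne : ∃ x, W x ≠ 0) :
    ((∀ l : ℝ, l < 0 → ∃ u : Ed d → ℝ, IsTest u ∧
        (∫ x, (‖gradient u x‖ ^ 2 - l * W x * u x ^ 2)) < 0) ↔
      (∫ x, W x) ≤ 0) := by
  have hWcont := hW.continuous
  constructor
  · intro H
    by_contra! hI
    obtain ⟨K, hK, hP⟩ := poincare hWcont hWc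
    set I := ∫ x, W x with hIdef
    obtain ⟨u, hu, hneg⟩ := H (-(2 * I / (K + 1))) (by
      have : 0 < 2 * I / (K + 1) := by positivity
      linarith)
    rw [Q_split hWcont hWc hu] at hneg
    have h1 := hP u hu
    rw [double_id hWcont hWc hu.1.continuous] at h1
    have hE : 0 ≤ ∫ x, ‖fderiv ℝ u x‖ ^ 2 := by positivity
    set E := ∫ x, ‖fderiv ℝ u x‖ ^ 2
    set B := ∫ x, W x * u x ^ 2
    have h2 : -(K * E) ≤ 2 * I * B := by nlinarith [sq_nonneg (∫ x, W x * u x)]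
    have h3 : E - -(2 * I / (K + 1)) * B = ((K + 1) * E + 2 * I * B) / (K + 1) := by
      field_simp; ring
    rw [h3] at hneg
    have : 0 ≤ ((K + 1) * E + 2 * I * B) / (K + 1) := by
      apply div_nonneg <;> linarith
    linarith
  · intro hI l hl
    have hWT : IsTest W := ⟨hW, hWc⟩
    obtain ⟨E, hE, hcut⟩ := cutoff1 (d := d) (by omega)
    obtain ⟨R, hR0, hR⟩ := hWc.isCompact.isBounded.subset_ball_lt 0 0
    have i1 : Integrable W := hWcont.integrable_of_hasCompactSupport hWc
    have i2 : Integrable (fun x => W x ^ 2) :=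
      (hWcont.pow 2).integrable_of_hasCompactSupport (cs_pow hWc 2 (by norm_num))
    have i3 : Integrable (fun x => W x ^ 3) :=
      (hWcont.pow 3).integrable_of_hasCompactSupport (cs_pow hWc 3 (by norm_num))
    have hB : 0 < ∫ x, W x ^ 2 := by
      obtain ⟨x0, hx0⟩ := hWne
      have hc2 : Continuous fun x => W x ^ 2 := hWcont.pow 2
      exact hc2.integral_pos_of_hasCompactSupport_nonneg_nonzero
        (cs_pow hWc 2 (by norm_num)) (fun x => sq_nonneg _)
        (x := x0) (by simpa using hx0)
    have hA : 0 ≤ ∫ x, ‖fderiv ℝ W x‖ ^ 2 := by positivity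
    set B := ∫ x, W x ^ 2
    set A := ∫ x, ‖fderiv ℝ W x‖ ^ 2
    set C := ∫ x, W x ^ 3
    set m := -l with hm
    have hm0 : 0 < m := by linarith
    set ε : ℝ := m * B / (2 * A + m * |C| + 1) with hε
    have hD : 0 < 2 * A + m * |C| + 1 := by positivity
    have hε0 : 0 < ε := by positivity
    have hεD : ε * (2 * A + m * |C| + 1) = m * B := by rw [hε]; field_simp
    obtain ⟨N, hN⟩ := exists_nat_gt (2 * E / (ε * m * B))
    obtain ⟨χ, c1, c2, c3⟩ := hcut R N
    have hc4 : 2 * (E / (N + 1)) < ε * m * B := by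
      rw [div_lt_iff₀ (by positivity)] at hN
      rw [← mul_div_assoc, div_lt_iff₀ (by positivity)]
      have : 0 < ε * m * B := by positivity
      nlinarith
    have hT : IsTest (fun x => χ x - ε * W x) := by
      refine ⟨c1.1.sub (contDiff_const.mul hW), c1.2.sub hWc.mul_left⟩
    refine ⟨_, hT, ?_⟩
    rw [Q_split hWcont hWc hT]
    have g1 : ∫ x, ‖fderiv ℝ (fun x => χ x - ε * W x) x‖ ^ 2 ≤
        2 * (E / (N + 1)) + 2 * ε ^ 2 * A := by
      calc _ ≤ ∫ x, (2 * ‖fderiv ℝ χ x‖ ^ 2 + 2 * ε ^ 2 * ‖fderiv ℝ W x‖ ^ 2) := by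
            apply integral_mono hT.int_sq ((c1.int_sq.const_mul _).add (hWT.int_sq.const_mul _))
            intro x
            have e1 : fderiv ℝ (fun x => χ x - ε * W x) x
                = fderiv ℝ χ x - ε • fderiv ℝ W x :=
              (((c1.diff x).hasFDerivAt).sub ((hWT.diff x).hasFDerivAt.const_mul ε)).fderiv
            have e2 := norm_sub_le (fderiv ℝ χ x) (ε • fderiv ℝ W x)
            rw [norm_smul, Real.norm_of_nonneg hε0.le] at e2
            simp only [e1]
            calc _ ≤ (‖fderiv ℝ χ x‖ + ε * ‖fderiv ℝ W x‖) ^ 2 := by gcongr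
              _ ≤ 2 * ‖fderiv ℝ χ x‖ ^ 2 + 2 * ε ^ 2 * ‖fderiv ℝ W x‖ ^ 2 := by
                nlinarith [sq_nonneg (‖fderiv ℝ χ x‖ - ε * ‖fderiv ℝ W x‖)]
        _ = 2 * (∫ x, ‖fderiv ℝ χ x‖ ^ 2) + 2 * ε ^ 2 * A := by
            rw [integral_add (c1.int_sq.const_mul _) (hWT.int_sq.const_mul _),
              integral_const_mul, integral_const_mul]
        _ ≤ _ := by gcongr
    have g2 : ∫ x, W x * (χ x - ε * W x) ^ 2 = (∫ x, W x) - 2 * ε * B + ε ^ 2 * C := by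
      have e : ∀ x, W x * (χ x - ε * W x) ^ 2 = W x - 2 * ε * W x ^ 2 + ε ^ 2 * W x ^ 3 := by
        intro x
        by_cases hx : W x = 0
        · simp [hx]
        · have : χ x = 1 := c2 x (by simpa using hR (subset_tsupport _ hx))
          rw [this]; ring
      simp_rw [e]
      rw [int3 i1 (i2.const_mul _) (i3.const_mul _), integral_const_mul, integral_const_mul]
    rw [g2]
    have hC : C ≤ |C| := le_abs_self C
    have q1 : m * (∫ x, W x) ≤ 0 := mul_nonpos_of_nonneg_of_nonpos hm0.le hI
    have q2 : ε ^ 2 * m * C ≤ ε ^ 2 * m * |C| := by gcongr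
    have q3 : ε ^ 2 * (2 * A + m * |C| + 1) = ε * m * B := by
      rw [pow_two, mul_assoc, hεD]; ring
    have hl' : l = -m := by simp [hm]
    rw [hl']
    nlinarith [sq_nonneg ε]
end
end
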